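/- Let h^0, ..., h^L be vectors in ℝ^d (with L ≥ 0 and d ≥ 1), let h̄ = (1/(L+1)) Σ_{l=0}^{L} h^l be their mean, and let Σ = (1/(L+1)) Σ_{l=0}^{L} (h^l − h̄)(h^l − h̄)ᵀ be their sample covariance matrix. Let μ = (1/(L+1)) Σ_{l=0}^{L} ‖h^l‖ be the mean norm, Var(‖h‖) = (1/(L+1)) Σ_{l=0}^{L} (‖h^l‖ − μ)² the variance of the norms, and assume μ > 0; set r_w = ‖h̄‖ / μ. Then the generalised variance satisfies det Σ ≤ ( (Var(‖h‖) + μ² (1 − r_w²)) / d )^d. -/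

import Mathlib

/-- The AM-GM inequality for eigenvalues: the determinant of a positive semidefinite matrix is at
most the `n`-th power of its normalised trace. -/
theorem Matrix.PosSemidef.det_le_trace_div_card_pow {n : Type*} [Fintype n] [DecidableEq n]
    [Nonempty n] {A : Matrix n n ℝ} (hA : A.PosSemidef) :
    A.det ≤ (A.trace / Fintype.card n) ^ Fintype.card n := by
  have hdet : A.det = ∏ i, hA.isHermitian.eigenvalues i := by
    simpa using hA.isHermitian.det_eq_prod_eigenvalues
  have htrace : A.trace = ∑ i, hA.isHermitian.eigenvalues i := by
    simpa using hA.isHermitian.trace_eq_sum_eigenvalues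
  have hpos : ∀ i, 0 ≤ hA.isHermitian.eigenvalues i := hA.eigenvalues_nonneg
  have hprod : 0 ≤ ∏ i, hA.isHermitian.eigenvalues i := Finset.prod_nonneg fun i _ => hpos i
  have key := Real.geom_mean_le_arith_mean Finset.univ (fun _ => (1 : ℝ))
    hA.isHermitian.eigenvalues (fun _ _ => zero_le_one)
    (by simp [Fintype.card_pos]) (fun i _ => hpos i)
  simp only [Real.rpow_one, Finset.sum_const, Finset.card_univ, nsmul_eq_mul, mul_one,
    one_mul] at key
  rw [hdet, htrace]
  calc ∏ i, hA.isHermitian.eigenvalues i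
      = ((∏ i, hA.isHermitian.eigenvalues i) ^ ((Fintype.card n : ℝ)⁻¹)) ^ Fintype.card n :=
        (Real.rpow_inv_natCast_pow hprod Fintype.card_ne_zero).symm
    _ ≤ _ := pow_le_pow_left₀ (Real.rpow_nonneg hprod _) key _

/-- The variance of vectors about their mean is the mean square norm minus the square norm of the
mean. -/
theorem mean_norm_sub_mean_sq {ι E : Type*} [Fintype ι] [Nonempty ι] [NormedAddCommGroup E]
    [InnerProductSpace ℝ E] (v : ι → E) (m : E) (hm : m = (Fintype.card ι : ℝ)⁻¹ • ∑ i, v i) :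
    (Fintype.card ι : ℝ)⁻¹ * ∑ i, ‖v i - m‖ ^ 2 =
      (Fintype.card ι : ℝ)⁻¹ * ∑ i, ‖v i‖ ^ 2 - ‖m‖ ^ 2 := by
  have hc : (Fintype.card ι : ℝ) ≠ 0 := by simp
  have hsum : ∑ i, v i = (Fintype.card ι : ℝ) • m := by rw [hm, smul_inv_smul₀ hc]
  have hinner : ∑ i, inner ℝ (v i) m = (Fintype.card ι : ℝ) * ‖m‖ ^ 2 := by
    rw [← sum_inner, hsum, real_inner_smul_left, real_inner_self_eq_norm_sq]
  simp only [norm_sub_sq_real, Finset.sum_add_distrib, Finset.sum_sub_distrib, ← Finset.mul_sum,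
    hinner, Finset.sum_const, Finset.card_univ, nsmul_eq_mul]
  field_simp
  ring

/-- Generalised variance bound. For vectors h^0,...,h^L in ℝ^d with
mean h̄, sample covariance Σ, mean norm μ > 0, norm variance Var(‖h‖), and
resultant length r_w = ‖h̄‖/μ, we have det Σ ≤ ((Var(‖h‖) + μ²(1 − r_w²))/d)^d. -/
theorem generalised_variance_bound (L d : ℕ) (hd : 1 ≤ d)
    (h : Fin (L + 1) → EuclideanSpace ℝ (Fin d))
    (hbar : EuclideanSpace ℝ (Fin d))
    (hhbar : hbar = (1 / (L + 1 : ℝ)) • ∑ l, h l)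
    (A : Matrix (Fin d) (Fin d) ℝ)
    (hA : A = Matrix.of fun i j =>
      (1 / (L + 1 : ℝ)) * ∑ l, (h l i - hbar i) * (h l j - hbar j))
    (μ V rw : ℝ)
    (hμdef : μ = (1 / (L + 1 : ℝ)) * ∑ l, ‖h l‖)
    (hVdef : V = (1 / (L + 1 : ℝ)) * ∑ l, (‖h l‖ - μ) ^ 2)
    (hμpos : 0 < μ)
    (hrw : rw = ‖hbar‖ / μ) :
    A.det ≤ ((V + μ ^ 2 * (1 - rw ^ 2)) / d) ^ d := by
  have : Nonempty (Fin d) := ⟨⟨0, hd⟩⟩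
  have hcard : (1 / (L + 1 : ℝ)) = (Fintype.card (Fin (L + 1)) : ℝ)⁻¹ := by simp
  have hpsd : A.PosSemidef := by
    let B : Matrix (Fin (L + 1)) (Fin d) ℝ := Matrix.of fun l i => h l i - hbar i
    have hAB : A = (1 / (L + 1 : ℝ)) • (B.conjTranspose * B) := by
      ext i j
      simp [hA, B, Matrix.mul_apply]
    rw [hAB]
    exact (Matrix.posSemidef_conjTranspose_mul_self B).smul (by positivity)
  have htrace : A.trace = (1 / (L + 1 : ℝ)) * ∑ l, ‖h l - hbar‖ ^ 2 := by
    simp only [hA, Matrix.trace, Matrix.diag_apply, Matrix.of_apply, ← Finset.mul_sum]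
    rw [Finset.sum_comm]
    simp only [EuclideanSpace.real_norm_sq_eq, PiLp.sub_apply, ← sq]
  have hvec : A.trace = (1 / (L + 1 : ℝ)) * ∑ l, ‖h l‖ ^ 2 - ‖hbar‖ ^ 2 := by
    rw [htrace, hcard]
    exact mean_norm_sub_mean_sq h hbar (hcard ▸ hhbar)
  have hV : V = (1 / (L + 1 : ℝ)) * ∑ l, ‖h l‖ ^ 2 - μ ^ 2 := by
    have hscalar := mean_norm_sub_mean_sq (fun l => ‖h l‖) μ (by rw [hμdef, hcard, smul_eq_mul])
    simp only [Real.norm_eq_abs, sq_abs] at hscalar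
    rw [hVdef, hcard]
    exact hscalar
  have hresultant : μ ^ 2 * rw ^ 2 = ‖hbar‖ ^ 2 := by
    rw [hrw]
    field_simp
  have hbound : V + μ ^ 2 * (1 - rw ^ 2) = A.trace := by
    linear_combination hV - hvec - hresultant
  rw [hbound]
  simpa using hpsd.det_le_trace_div_card_pow
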